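/- Let G be a d-regular simple graph with edge-connectivity κ'(G) = r, where r ≤ d − 1 and r is odd. If S is a nonempty proper vertex subset such that the number of edges with exactly one endpoint in S equals r, then both S and its complement contain at least d + 2 vertices. -/

import Mathlib

open Finset

/-- Number of edges of `G` with exactly one endpoint in `S`, counted as ordered pairs
`(u, v)` with `u ∈ S`, `v ∉ S`, `G.Adj u v`. -/
noncomputable def cutCard {V : Type*} [Fintype V] (G : SimpleGraph V) (S : Finset V) : ℕ := by
  classical
  exact (Finset.univ.filter (fun p : V × V => p.1 ∈ S ∧ p.2 ∉ S ∧ G.Adj p.1 p.2)).card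

/-- The edge-connectivity of a finite graph: the minimum of `cutCard G S` over nonempty
proper vertex subsets `S`. -/
noncomputable def edgeConn {V : Type*} [Fintype V] (G : SimpleGraph V) : ℕ :=
  sInf {k | ∃ S : Finset V, S.Nonempty ∧ S ≠ Finset.univ ∧ cutCard G S = k}

open scoped Classical in
theorem cutCard_eq_sum {V : Type*} [Fintype V] (G : SimpleGraph V) (S : Finset V) :
    cutCard G S = ∑ v ∈ S, #{w | w ∉ S ∧ G.Adj v w} := by
  simp only [cutCard, Finset.card_filter, Fintype.sum_prod_type]
  rw [← Finset.sum_subset (Finset.subset_univ S)]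
  · exact Finset.sum_congr rfl fun v hv => Finset.sum_congr rfl fun w _ => by simp [hv]
  · intro v _ hv
    simp [hv]

open scoped Classical in
theorem cutCard_compl {V : Type*} [Fintype V] (G : SimpleGraph V) (S : Finset V) :
    cutCard G Sᶜ = cutCard G S := by
  unfold cutCard
  refine Finset.card_bij' (fun p _ => p.swap) (fun p _ => p.swap) ?_ ?_ ?_ ?_
  · rintro ⟨u, v⟩ h
    simp_all [G.adj_comm]
  · rintro ⟨u, v⟩ h
    simp_all [G.adj_comm]
  · simp
  · simp

open scoped Classical in
theorem even_sum_card_adj_within {V : Type*} [Fintype V] (G : SimpleGraph V) (S : Finset V) :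
    Even (∑ v ∈ S, #{w | w ∈ S ∧ G.Adj v w}) := by
  let H : SimpleGraph V :=
    { Adj := fun u v => u ∈ S ∧ v ∈ S ∧ G.Adj u v
      symm := ⟨fun _ _ h => ⟨h.2.1, h.1, h.2.2.symm⟩⟩
      loopless := ⟨fun _ h => G.irrefl h.2.2⟩ }
  have hH : ∑ v, H.degree v = ∑ v ∈ S, #{w | w ∈ S ∧ G.Adj v w} := by
    rw [← Finset.sum_subset (Finset.subset_univ S)]
    · refine Finset.sum_congr rfl fun v hv => ?_
      rw [← H.card_neighborFinset_eq_degree, H.neighborFinset_eq_filter]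
      congr 1
      ext w
      simp [H, hv]
    · intro v _ hv
      rw [← H.card_neighborFinset_eq_degree, H.neighborFinset_eq_filter]
      simp [H, hv]
  rw [← hH, H.sum_degrees_eq_twice_card_edges]
  exact even_two_mul _

open scoped Classical in
theorem card_adj_within_add_card_adj_outside {V : Type*} [Fintype V] {G : SimpleGraph V} {d : ℕ}
    (hreg : G.IsRegularOfDegree d) (S : Finset V) (v : V) :
    #{w | w ∈ S ∧ G.Adj v w} + #{w | w ∉ S ∧ G.Adj v w} = d := by
  rw [← hreg v, ← G.card_neighborFinset_eq_degree, G.neighborFinset_eq_filter,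
    ← Finset.card_filter_add_card_filter_not (s := {w | G.Adj v w}) (· ∈ S)]
  simp only [Finset.filter_filter, and_comm]

open scoped Classical in
/-- In a `d`-regular graph, a nonempty vertex set with an odd edge cut of size less than `d`
has at least `d + 2` vertices. -/
theorem add_two_le_card_of_odd_cutCard {V : Type*} [Fintype V] {G : SimpleGraph V} {d : ℕ}
    (hreg : G.IsRegularOfDegree d) {S : Finset V} (hS : S.Nonempty)
    (hlt : cutCard G S < d) (hodd : Odd (cutCard G S)) : d + 2 ≤ #S := by
  have hpos : 1 ≤ #S := hS.card_pos
  have hsum : ∑ v ∈ S, #{w | w ∈ S ∧ G.Adj v w} + cutCard G S = #S * d := by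
    rw [cutCard_eq_sum, ← Finset.sum_add_distrib,
      Finset.sum_congr rfl fun v _ => card_adj_within_add_card_adj_outside hreg S v]
    simp
  have hin : ∑ v ∈ S, #{w | w ∈ S ∧ G.Adj v w} ≤ #S * (#S - 1) := by
    rw [← smul_eq_mul]
    refine Finset.sum_le_card_nsmul _ _ _ fun v hv => ?_
    rw [← Finset.card_erase_of_mem hv]
    refine Finset.card_le_card fun w hw => ?_
    simp only [Finset.mem_filter, Finset.mem_univ, true_and] at hw
    exact Finset.mem_erase.2 ⟨hw.2.ne', hw.1⟩
  have hodd' : Odd (#S * d) := hsum ▸ (even_sum_card_adj_within G S).add_odd hodd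
  obtain ⟨⟨a, ha⟩, ⟨b, hb⟩⟩ := Nat.odd_mul.1 hodd'
  by_contra! hcon
  have hle : #S ≤ d := by omega
  obtain ⟨m, hm⟩ := Nat.exists_eq_add_of_le' hpos
  obtain ⟨c, hc⟩ := Nat.exists_eq_add_of_le hle
  rw [hm] at hsum hin hc
  simp only [Nat.add_sub_cancel] at hin
  nlinarith [Nat.zero_le (m * c)]

open scoped Classical in
theorem stmt4 {V : Type*} [Fintype V] (d r : ℕ) (G : SimpleGraph V)
    (hreg : G.IsRegularOfDegree d) (hk : edgeConn G = r) (hr : (r : ℤ) ≤ (d : ℤ) - 1) (hrodd : Odd r)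
    (S : Finset V) (hS : S.Nonempty) (hSproper : S ≠ Finset.univ)
    (hcut : cutCard G S = r) :
    d + 2 ≤ S.card ∧ d + 2 ≤ Sᶜ.card := by
  have hSc : Sᶜ.Nonempty := by
    rwa [Finset.nonempty_iff_ne_empty, Ne, Finset.compl_eq_empty_iff]
  have hcut' : cutCard G Sᶜ = r := (cutCard_compl G S).trans hcut
  exact ⟨add_two_le_card_of_odd_cutCard hreg hS (by omega) (hcut ▸ hrodd),
    add_two_le_card_of_odd_cutCard hreg hSc (by omega) (hcut' ▸ hrodd)⟩
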